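/- Fix s > 0, a positive integer M, and a nonnegative integer N. Let φ : ℝ → ℝ be infinitely differentiable with φ(x) = 1 for x ∈ [0,2] and φ(x) = 0 for x ≥ 4. For u ∈ ℝ define m_u : (0,∞) → ℂ by m_u(λ) = λ^{2M} (λ^{2iu} − 1) φ(sλ²), where λ^{2iu} = exp(2iu log λ). Then for every j with 0 ≤ j ≤ N there is a constant C > 0 (depending on j, M, s, φ but not on u) such that for all u with |u| ≤ 1, sup_{λ>0} λ^j | m_u^{(j)}(λ) | ≤ C · |u|. -/

import Mathlib

lemma aux_A (s : ℝ) (hs : 0 < s) (M : ℕ) (hM : 0 < M)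
    (φ : ℝ → ℝ) (hφ : ContDiff ℝ (⊤ : ℕ∞) φ)
    (hφ0 : ∀ x : ℝ, 4 ≤ x → φ x = 0) :
    ContDiff ℝ (⊤ : ℕ∞) (fun y : ℝ => (y : ℂ) ^ (2 * M) * (φ (s * y ^ 2) : ℂ)) ∧
    ∃ R : ℝ, 0 < R ∧ ∀ j : ℕ, ∃ C : ℝ, 0 ≤ C ∧ ∀ x : ℝ, 0 < x →
      (R < x → iteratedDeriv j (fun y : ℝ => (y : ℂ) ^ (2 * M) * (φ (s * y ^ 2) : ℂ)) x = 0) ∧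
      (x ≤ R → x ^ j * ‖iteratedDeriv j
        (fun y : ℝ => (y : ℂ) ^ (2 * M) * (φ (s * y ^ 2) : ℂ)) x‖ ≤ C * x) := by
  have hsm : ContDiff ℝ (⊤ : ℕ∞) (fun y : ℝ => (y : ℂ) ^ (2 * M) * (φ (s * y ^ 2) : ℂ)) := by
    have h1 : ContDiff ℝ (⊤ : ℕ∞) (fun y : ℝ => (y : ℂ)) := Complex.ofRealCLM.contDiff
    have h2 : ContDiff ℝ (⊤ : ℕ∞) (fun y : ℝ => φ (s * y ^ 2)) :=
      hφ.comp (by fun_prop)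
    exact (h1.pow _).mul (Complex.ofRealCLM.contDiff.comp h2)
  refine ⟨hsm, 1 + 4 / s, by positivity, fun j => ?_⟩
  set R := 1 + 4 / s with hR
  have hR0 : 0 < R := by positivity
  have hsR : 4 ≤ s * R ^ 2 := by
    have h1 : s * R = s + 4 := by rw [hR]; field_simp
    have h2 : 1 ≤ R := by rw [hR]; have : 0 < 4 / s := by positivity
                          linarith
    nlinarith
  have hz : ∀ x : ℝ, R < x →
      iteratedDeriv j (fun y : ℝ => (y : ℂ) ^ (2 * M) * (φ (s * y ^ 2) : ℂ)) x = 0 := by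
    intro x hx
    have : (fun y : ℝ => (y : ℂ) ^ (2 * M) * (φ (s * y ^ 2) : ℂ)) =ᶠ[nhds x] fun _ => 0 := by
      filter_upwards [Ioi_mem_nhds hx] with y hy
      have hy' : R < y := hy
      rw [hφ0 _ (by nlinarith [mul_pos hs (sub_pos.2 hy')])]
      simp
    rw [this.iteratedDeriv_eq]
    simp
  rcases j with _ | j
  · have hc : Continuous (fun y : ℝ => (y : ℂ) ^ (2 * M - 1) * (φ (s * y ^ 2) : ℂ)) := by
      have := hφ.continuous
      fun_prop
    obtain ⟨C, hC⟩ := (isCompact_Icc (a := (0:ℝ)) (b := R)).exists_bound_of_continuousOn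
      hc.continuousOn
    refine ⟨C, (norm_nonneg _).trans (hC 0 ⟨le_rfl, hR0.le⟩), fun x hx => ⟨hz x, fun hxR => ?_⟩⟩
    have := hC x ⟨hx.le, hxR⟩
    have e : (x : ℂ) ^ (2 * M) = x ^ (2 * M - 1) * x := by
      rw [← pow_succ]; congr 1; omega
    simp only [iteratedDeriv_zero, pow_zero, one_mul]
    rw [e, mul_right_comm, norm_mul, Complex.norm_real, Real.norm_of_nonneg hx.le]
    gcongr
  · have hc := hsm.continuous_iteratedDeriv (j + 1) (by exact_mod_cast le_top)
    obtain ⟨C, hC⟩ := (isCompact_Icc (a := (0:ℝ)) (b := R)).exists_bound_of_continuousOn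
      hc.continuousOn
    have hC0 : 0 ≤ C := (norm_nonneg _).trans (hC 0 ⟨le_rfl, hR0.le⟩)
    refine ⟨R ^ j * C, by positivity, fun x hx => ⟨hz x, fun hxR => ?_⟩⟩
    have := hC x ⟨hx.le, hxR⟩
    calc _ ≤ (R ^ j * x) * C := by rw [pow_succ]; gcongr
      _ = _ := by ring

lemma aux_E_formula (u : ℝ) (j : ℕ) : ∃ c : ℂ, ‖c‖ ≤ 2 * |u| * (2 * |u| + j) ^ j ∧
    ∀ x : ℝ, 0 < x → iteratedDerivWithin (j + 1)
      (fun y : ℝ => Complex.exp (2 * Complex.I * u * Real.log y) - 1) (Set.Ioi 0) x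
      = c * (x : ℂ)⁻¹ ^ (j + 1) * Complex.exp (2 * Complex.I * u * Real.log x) := by
  have hE : ∀ x : ℝ, 0 < x → HasDerivAt
      (fun y : ℝ => Complex.exp (2 * Complex.I * u * Real.log y))
      (Complex.exp (2 * Complex.I * u * Real.log x) * (2 * Complex.I * u * (x : ℂ)⁻¹)) x := by
    intro x hx
    have h := ((Real.hasDerivAt_log hx.ne').ofReal_comp.const_mul (2 * Complex.I * u)).cexp
    simpa using h
  induction j with
  | zero =>
    refine ⟨2 * Complex.I * u, by simp, fun x hx => ?_⟩
    rw [iteratedDerivWithin_succ, iteratedDerivWithin_zero,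
      (((hE x hx).sub_const 1).hasDerivWithinAt).derivWithin (uniqueDiffOn_Ioi 0 x hx)]
    ring
  | succ j ih =>
    obtain ⟨c, hc, hf⟩ := ih
    refine ⟨c * (2 * Complex.I * u - (j + 1)), ?_, fun x hx => ?_⟩
    · rw [norm_mul]
      have h1 : ‖2 * Complex.I * u - ((j : ℂ) + 1)‖ ≤ 2 * |u| + (j + 1 : ℕ) := by
        refine (norm_sub_le _ _).trans ?_
        have : ‖(j : ℂ) + 1‖ = (j + 1 : ℕ) := by
          rw [← Complex.norm_natCast]; push_cast; rfl
        rw [this]; simp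
      calc _ ≤ (2 * |u| * (2 * |u| + (j + 1 : ℕ)) ^ j) * (2 * |u| + (j + 1 : ℕ)) := by
            gcongr
            refine hc.trans ?_
            gcongr
            simp
        _ = _ := by ring
    · rw [iteratedDerivWithin_succ, derivWithin_congr (s := Set.Ioi 0) (fun y hy => hf y hy) (hf x hx)]
      have hx' : (x : ℂ) ≠ 0 := by exact_mod_cast hx.ne'
      have hi : HasDerivAt (fun y : ℝ => (y : ℂ)⁻¹) (-((x : ℂ) ^ 2)⁻¹) x :=
        (hasDerivAt_inv hx').comp_ofReal
      have h := ((hi.pow (j + 1)).const_mul c).mul (hE x hx)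
      have h2 := h.hasDerivWithinAt (s := Set.Ioi 0) |>.derivWithin (uniqueDiffOn_Ioi 0 x hx)
      refine Eq.trans h2 ?_
      simp only [add_tsub_cancel_right, Pi.pow_apply, Nat.cast_add, Nat.cast_one]
      ring

lemma aux_E (j : ℕ) : ∃ C : ℝ, 0 ≤ C ∧ ∀ u : ℝ, |u| ≤ 1 → ∀ x : ℝ, 0 < x →
    x ^ j * ‖iteratedDerivWithin j
      (fun y : ℝ => Complex.exp (2 * Complex.I * u * Real.log y) - 1) (Set.Ioi 0) x‖
      ≤ C * |u| * (1 + |Real.log x|) := by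
  have e : ∀ u x : ℝ, (2 * Complex.I * u * Real.log x) =
      Complex.I * ((2 * u * Real.log x : ℝ) : ℂ) := by
    intro u x; push_cast; ring
  rcases j with _ | j
  · refine ⟨2, by norm_num, fun u hu x hx => ?_⟩
    simp only [iteratedDerivWithin_zero, pow_zero, one_mul]
    rw [e]
    refine (Real.norm_exp_I_mul_ofReal_sub_one_le).trans ?_
    rw [Real.norm_eq_abs, abs_mul, abs_mul, abs_two]
    gcongr
    linarith
  · refine ⟨2 * (2 + j) ^ j, by positivity, fun u hu x hx => ?_⟩
    obtain ⟨c, hc, hf⟩ := aux_E_formula u j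
    rw [hf x hx, norm_mul, norm_mul, e, mul_comm Complex.I, Complex.norm_exp_ofReal_mul_I,
      norm_pow, norm_inv, Complex.norm_real, Real.norm_of_nonneg hx.le]
    have : x ^ (j + 1) * (‖c‖ * x⁻¹ ^ (j + 1) * 1) = ‖c‖ := by
      rw [inv_pow]; field_simp
    rw [this]
    calc ‖c‖ ≤ 2 * |u| * (2 * |u| + j) ^ j := hc
      _ ≤ 2 * |u| * (2 * 1 + j) ^ j := by gcongr
      _ = (2 * (2 + j) ^ j * |u|) * 1 := by ring
      _ ≤ _ := by gcongr; linarith [abs_nonneg (Real.log x)]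

lemma aux_log (x : ℝ) (hx : 0 < x) : x * (1 + |Real.log x|) ≤ x + 1 + x ^ 2 := by
  rcases le_total x 1 with h | h
  · have := Real.abs_log_mul_self_lt x hx h
    rw [abs_mul, abs_of_pos hx] at this
    nlinarith
  · rw [abs_of_nonneg (Real.log_nonneg h)]
    nlinarith [Real.log_le_sub_one_of_pos hx]

/-- The Mikhlin constants of order up to `N` of the multiplier
`m_u(λ) = λ^{2M} (λ^{2iu} − 1) φ(sλ²)` are `O(|u|)` uniformly for `|u| ≤ 1`:
for each `j ≤ N` there is `C > 0` (independent of `u`) with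
`λ^j |m_u^{(j)}(λ)| ≤ C |u|` for all `λ > 0`. -/
theorem stmt_9 (s : ℝ) (hs : 0 < s) (M : ℕ) (hM : 0 < M) (N : ℕ)
    (φ : ℝ → ℝ) (hφ : ContDiff ℝ (⊤ : ℕ∞) φ)
    (hφ1 : ∀ x ∈ Set.Icc (0:ℝ) 2, φ x = 1) (hφ0 : ∀ x : ℝ, 4 ≤ x → φ x = 0) :
    ∀ j ≤ N, ∃ C : ℝ, 0 < C ∧ ∀ u : ℝ, |u| ≤ 1 → ∀ x : ℝ, 0 < x →
      x ^ j * ‖iteratedDerivWithin j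
          (fun y : ℝ => (y : ℂ) ^ (2 * M) *
            (Complex.exp (2 * Complex.I * u * Real.log y) - 1) * (φ (s * y ^ 2) : ℂ))
          (Set.Ioi 0) x‖ ≤ C * |u| := by
  intro j _
  obtain ⟨hsm, R, hR, hA⟩ := aux_A s hs M hM φ hφ hφ0
  choose A hA0 hA using hA
  choose B hB0 hB using aux_E
  set K := ∑ i ∈ Finset.range (j + 1), (j.choose i : ℝ) * A i * B (j - i) * (R + 1 + R ^ 2) with hK
  have hK0 : 0 ≤ K := Finset.sum_nonneg fun i _ => by
    have := hA0 i
    have := hB0 (j - i)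
    positivity
  refine ⟨K + 1, by positivity, fun u hu x hx => ?_⟩
  set f : ℝ → ℂ := fun y : ℝ => (y : ℂ) ^ (2 * M) * (φ (s * y ^ 2) : ℂ) with hf
  set g : ℝ → ℂ := fun y : ℝ => Complex.exp (2 * Complex.I * u * Real.log y) - 1 with hg
  have hfg : (fun y : ℝ => (y : ℂ) ^ (2 * M) *
            (Complex.exp (2 * Complex.I * u * Real.log y) - 1) * (φ (s * y ^ 2) : ℂ))
      = fun y => f y * g y := by
    funext y; simp only [hf, hg]; ring
  have hgs : ContDiffOn ℝ (⊤ : ℕ∞) g (Set.Ioi 0) := by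
    have h1 : ContDiffOn ℝ (⊤ : ℕ∞) Real.log (Set.Ioi 0) :=
      Real.contDiffOn_log.mono (fun y hy => (ne_of_gt hy : y ≠ 0))
    have h2 : ContDiffOn ℝ (⊤ : ℕ∞) (fun y => (Real.log y : ℂ)) (Set.Ioi 0) :=
      Complex.ofRealCLM.contDiff.comp_contDiffOn h1
    exact ((contDiffOn_const.mul h2).cexp).sub contDiffOn_const
  rw [hfg]
  have hL := norm_iteratedFDerivWithin_mul_le (n := j) (N := ((⊤ : ℕ∞) : WithTop ℕ∞))
    hsm.contDiffOn hgs (uniqueDiffOn_Ioi (0:ℝ)) (Set.mem_Ioi.2 hx) (by exact_mod_cast le_top)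
  simp only [norm_iteratedFDerivWithin_eq_norm_iteratedDerivWithin] at hL
  have hO : ∀ i, iteratedDerivWithin i f (Set.Ioi 0) x = iteratedDeriv i f x := fun i =>
    iteratedDerivWithin_of_isOpen isOpen_Ioi hx
  calc _ ≤ x ^ j * ∑ i ∈ Finset.range (j + 1), (j.choose i : ℝ) *
        ‖iteratedDerivWithin i f (Set.Ioi 0) x‖ * ‖iteratedDerivWithin (j - i) g (Set.Ioi 0) x‖ := by
        gcongr
    _ ≤ K * |u| := by
      rw [Finset.mul_sum, hK, Finset.sum_mul]
      refine Finset.sum_le_sum fun i hi => ?_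
      rw [hO]
      have := hA0 i
      have := hB0 (j - i)
      rcases lt_or_ge R x with h | h
      · rw [((hA i x hx).1 h)]
        simp only [norm_zero, mul_zero, zero_mul]
        positivity
      · have h1 := (hA i x hx).2 h
        have h2 := hB (j - i) u hu x hx
        have hp : x ^ j = x ^ i * x ^ (j - i) := by
          rw [← pow_add]; congr 1; have := Finset.mem_range.1 hi; omega
        calc _ = (j.choose i : ℝ) * ((x ^ i * ‖iteratedDeriv i f x‖) *
              (x ^ (j - i) * ‖iteratedDerivWithin (j - i) g (Set.Ioi 0) x‖)) := by
              rw [hp]; ring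
          _ ≤ (j.choose i : ℝ) * ((A i * x) * (B (j - i) * |u| * (1 + |Real.log x|))) := by
              gcongr
          _ = (j.choose i : ℝ) * A i * B (j - i) * (x * (1 + |Real.log x|)) * |u| := by ring
          _ ≤ (j.choose i : ℝ) * A i * B (j - i) * (R + 1 + R ^ 2) * |u| := by
              gcongr
              refine (aux_log x hx).trans ?_
              gcongr
    _ ≤ _ := by gcongr; linarith
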